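/- For every integer t ≥ 4, the Galois group of the splitting field of g₄(x;t) = x⁴ − (t+3)·x³ + t·x + 1 over ℚ is isomorphic to the symmetric group S₄. -/

import Mathlib

open Polynomial

/-- The resolvent cubic of `X ^ 4 + a X ^ 3 + b X ^ 2 + c X + d`. If the quartic has roots
`x₀, x₁, x₂, x₃`, the resolvent has roots `x₀ x₁ + x₂ x₃`, `x₀ x₂ + x₁ x₃`, `x₀ x₃ + x₁ x₂`. -/
def resolventCubic {F : Type*} [CommRing F] (a b c d : F) : Cubic F :=
  ⟨1, -b, a * c - 4 * d, -(a ^ 2 * d - 4 * b * d + c ^ 2)⟩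

/-- A subgroup of `S₄` of order divisible by `12` and containing an odd permutation is `S₄`. -/
theorem Subgroup.eq_top_of_twelve_dvd_card {H : Subgroup (Equiv.Perm (Fin 4))}
    (hcard : 12 ∣ Nat.card H) (hodd : ¬ H ≤ alternatingGroup (Fin 4)) : H = ⊤ := by
  have hmul := H.card_mul_index
  have h24 : Nat.card (Equiv.Perm (Fin 4)) = 24 := by
    rw [Nat.card_eq_fintype_card, Fintype.card_perm, Fintype.card_fin]; rfl
  rw [h24] at hmul
  obtain ⟨k, hk⟩ := hcard
  have hle : H.index ∣ 2 := ⟨k, by rw [hk] at hmul; linarith⟩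
  rcases (Nat.dvd_prime Nat.prime_two).mp hle with h | h
  · exact Subgroup.index_eq_one.mp h
  · exact absurd (Equiv.Perm.eq_alternatingGroup_of_index_eq_two h).le hodd

/-- A separable polynomial that splits, with roots indexed by `Fin n`: the Galois group embeds
into `Perm (Fin n)` by its action on the indices. -/
theorem Polynomial.Gal.exists_perm_fin {F : Type*} [Field F] {p : F[X]} (hp : p.Separable)
    (hm : p.Monic) {n : ℕ} (hn : p.natDegree = n) :
    ∃ (r : Fin n → p.SplittingField) (φ : p.Gal →* Equiv.Perm (Fin n)),
      p.map (algebraMap F p.SplittingField) = ∏ i, (X - C (r i)) ∧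
      Function.Injective φ ∧ ∀ (σ : p.Gal) (i : Fin n), σ (r i) = r (φ σ i) := by
  classical
  have hs := SplittingField.splits p
  have hcard : Fintype.card (p.rootSet p.SplittingField) = n :=
    (card_rootSet_eq_natDegree hp hs).trans hn
  let e : Fin n ≃ p.rootSet p.SplittingField := (Fintype.equivFinOfCardEq hcard).symm
  let φ : p.Gal →* Equiv.Perm (Fin n) :=
    e.symm.permCongrHom.toMonoidHom.comp
      (MulAction.toPermHom p.Gal (p.rootSet p.SplittingField))
  have key (σ : p.Gal) (i : Fin n) :
      σ ((e i : p.SplittingField)) = e (φ σ i) := by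
    simp [φ]
    rfl
  refine ⟨fun i ↦ e i, φ, ?_, ?_, key⟩
  · rw [Fintype.prod_equiv e _ (fun x : p.rootSet p.SplittingField ↦ X - C (x : p.SplittingField))
      fun _ ↦ rfl]
    conv_lhs => rw [hs.eq_prod_roots, (hm.map _).leadingCoeff, C_1, one_mul]
    have hnd : (p.map (algebraMap F p.SplittingField)).roots.Nodup := nodup_roots hp.map
    rw [← Finset.prod_subtype (p := (· ∈ p.rootSet p.SplittingField))
      (p.map (algebraMap F p.SplittingField)).roots.toFinset
      (fun x ↦ by rw [rootSet_def, Finset.mem_coe, aroots_def])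
      (fun x ↦ X - C x), Finset.prod_eq_multiset_prod, Multiset.toFinset_val, hnd.dedup]
  · intro σ τ h
    refine Gal.ext _ fun x hx ↦ ?_
    have := key σ (e.symm ⟨x, hx⟩)
    rw [h, ← key τ] at this
    simpa using this

theorem coeffs_eq_of_quartic_eq {R : Type*} [CommRing R] {a b c d a' b' c' d' : R}
    (h : (X ^ 4 + C a * X ^ 3 + C b * X ^ 2 + C c * X + C d : R[X]) =
      X ^ 4 + C a' * X ^ 3 + C b' * X ^ 2 + C c' * X + C d') :
    a = a' ∧ b = b' ∧ c = c' ∧ d = d' := by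
  have hcubic : Cubic.toPoly ⟨a, b, c, d⟩ = Cubic.toPoly ⟨a', b', c', d'⟩ := by
    simp only [Cubic.toPoly]
    linear_combination h
  simpa using (Cubic.toPoly_injective _ _).mp hcubic

/-- A monic irreducible quartic whose resolvent cubic is irreducible with non-square discriminant
has Galois group `S₄`. -/
theorem Polynomial.Gal.nonempty_mulEquiv_perm_fin_four {F : Type*} [Field F] [CharZero F]
    {a b c d : F} {p : F[X]} (hp : p = X ^ 4 + C a * X ^ 3 + C b * X ^ 2 + C c * X + C d)
    (hirr : Irreducible p) (hres : Irreducible (resolventCubic a b c d).toPoly)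
    (hdiscr : ¬ IsSquare (resolventCubic a b c d).discr) :
    Nonempty (p.Gal ≃* Equiv.Perm (Fin 4)) := by
  have hdeg : p.natDegree = 4 := by rw [hp]; compute_degree!
  have hm : p.Monic := by rw [hp]; monicity!
  have hsep := hirr.separable
  have : IsGalois F p.SplittingField := IsGalois.of_separable_splitting_field hsep
  obtain ⟨r, φ, hprod, hinj, hφ⟩ := Gal.exists_perm_fin hsep hm hdeg
  set ι := algebraMap F p.SplittingField with hι
  have hprod' : ∏ i, (X - C (r i)) = X ^ 4 + C (-(r 0 + r 1 + r 2 + r 3)) * X ^ 3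
      + C (r 0 * r 1 + r 0 * r 2 + r 0 * r 3 + r 1 * r 2 + r 1 * r 3 + r 2 * r 3) * X ^ 2
      + C (-(r 0 * r 1 * r 2 + r 0 * r 1 * r 3 + r 0 * r 2 * r 3 + r 1 * r 2 * r 3)) * X
      + C (r 0 * r 1 * r 2 * r 3) := by
    simp only [Fin.prod_univ_four, map_add, map_mul, map_neg]
    ring
  have hmap : p.map ι = X ^ 4 + C (ι a) * X ^ 3 + C (ι b) * X ^ 2 + C (ι c) * X + C (ι d) := by
    simp [hp]
  obtain ⟨ha, hb, hc, hd⟩ := coeffs_eq_of_quartic_eq (hmap.symm.trans (hprod.trans hprod'))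
  have h4 : 4 ∣ Nat.card p.Gal := by
    rw [Gal.card_of_separable hsep, ← hdeg]
    exact hirr.natDegree_dvd_finrank (SplittingField.splits p)
  have h3 : 3 ∣ Nat.card p.Gal := by
    rw [Gal.card_of_separable hsep,
      ← Cubic.natDegree_of_a_ne_zero (P := resolventCubic a b c d) one_ne_zero,
      minpoly.eq_of_irreducible_of_monic hres (x := r 0 * r 1 + r 2 * r 3) ?_
        (Cubic.monic_of_a_eq_one rfl)]
    · exact minpoly.degree_dvd (.of_finite F _)
    simp only [resolventCubic, Cubic.toPoly, map_add, map_mul, map_neg, map_sub, map_pow, aeval_X,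
      aeval_C, ← hι, ha, hb, hc, hd, map_one, map_ofNat]
    ring
  have hcard : Nat.card φ.range = Nat.card p.Gal :=
    (Nat.card_congr (MonoidHom.ofInjective hinj).toEquiv).symm
  have htop : φ.range = ⊤ := by
    refine Subgroup.eq_top_of_twelve_dvd_card ?_ fun hle ↦ hdiscr ?_
    · rw [hcard]
      exact Nat.Coprime.mul_dvd_of_dvd_of_dvd (by norm_num) h3 h4
    have hfix (σ : p.Gal) : σ (Matrix.vandermonde r).det = (Matrix.vandermonde r).det := by
      have hsub : (Matrix.vandermonde r).map σ =
          (Matrix.vandermonde r).submatrix (φ σ) id := by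
        ext i j
        simp [Matrix.vandermonde_apply, hφ]
      have hsign : Equiv.Perm.sign (φ σ) = 1 :=
        Equiv.Perm.mem_alternatingGroup.mp (hle ⟨σ, rfl⟩)
      have hdet : σ (Matrix.vandermonde r).det = ((Matrix.vandermonde r).map σ).det :=
        AlgEquiv.map_det σ (Matrix.vandermonde r)
      rw [hdet, hsub, Matrix.det_permute, hsign]
      simp
    obtain ⟨q, hq⟩ := IntermediateField.mem_bot.mp
      ((IsGalois.mem_bot_iff_fixed (F := F) (Matrix.vandermonde r).det).mpr hfix)
    refine ⟨q, FaithfulSMul.algebraMap_injective F p.SplittingField ?_⟩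
    rw [map_mul, hq, Matrix.det_vandermonde]
    simp only [resolventCubic, Cubic.discr, map_add, map_mul, map_neg, map_sub, map_pow,
      ← hι, ha, hb, hc, hd, map_one, map_ofNat]
    simp only [Fin.prod_univ_four, show Finset.Ioi (0 : Fin 4) = {1, 2, 3} by decide,
      show Finset.Ioi (1 : Fin 4) = {2, 3} by decide, show Finset.Ioi (2 : Fin 4) = {3} by decide,
      show Finset.Ioi (3 : Fin 4) = ∅ by decide]
    simp
    ring
  exact ⟨MulEquiv.ofBijective φ ⟨hinj, MonoidHom.range_eq_top.mp htop⟩⟩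

theorem monic_quartic_int (t : ℤ) : (X ^ 4 - C (t + 3) * X ^ 3 + C t * X + 1 : ℤ[X]).Monic := by
  monicity!

/-- The quartics `X ^ 4 - (t + 3) X ^ 3 + t X + 1` are irreducible over `ℤ`. -/
theorem irreducible_quartic_int (t : ℤ) :
    Irreducible (X ^ 4 - C (t + 3) * X ^ 3 + C t * X + 1 : ℤ[X]) := by
  have hm := monic_quartic_int t
  have hdeg : (X ^ 4 - C (t + 3) * X ^ 3 + C t * X + 1 : ℤ[X]).natDegree = 4 := by
    compute_degree!
  refine (hm.irreducible_iff_natDegree').mpr ⟨fun h ↦ ?_, ?_⟩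
  · rw [h, natDegree_one] at hdeg
    omega
  intro f g hf hg hfg hmem
  have hadd : f.natDegree + g.natDegree = 4 := by rw [← hf.natDegree_mul hg, hfg, hdeg]
  rw [hdeg, Finset.mem_Ioc] at hmem
  obtain h | h : g.natDegree = 1 ∨ g.natDegree = 2 := by omega
  · have heval := congrArg (eval (-g.coeff 0)) hfg
    rw [hg.eq_X_add_C h] at heval
    simp only [coeff_add, coeff_X_zero, coeff_C_zero, zero_add, eval_mul, eval_add, eval_X, eval_C,
      neg_add_cancel, mul_zero, eval_sub, eval_pow, eval_one] at heval
    generalize g.coeff 0 = x at heval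
    have hx : x ∣ 1 := ⟨-x ^ 3 - (t + 3) * x ^ 2 + t, by linarith⟩
    rcases Int.isUnit_iff.mp (isUnit_of_dvd_one hx) with rfl | rfl <;> norm_num at heval <;> omega
  · have hquad {q : ℤ[X]} (hq : q.Monic) (hq2 : q.natDegree = 2) :
        q = X ^ 2 + C (q.coeff 1) * X + C (q.coeff 0) := by
      conv_lhs => rw [hq.as_sum, hq2]
      simp [Finset.sum_range_succ]
      ring
    have hprod : f * g = X ^ 4 + C (f.coeff 1 + g.coeff 1) * X ^ 3
        + C (f.coeff 0 + g.coeff 0 + f.coeff 1 * g.coeff 1) * X ^ 2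
        + C (f.coeff 1 * g.coeff 0 + f.coeff 0 * g.coeff 1) * X + C (f.coeff 0 * g.coeff 0) := by
      conv_lhs => rw [hquad hf (by omega), hquad hg h]
      simp only [map_add, map_mul]
      ring
    have hquartic : (X ^ 4 - C (t + 3) * X ^ 3 + C t * X + 1 : ℤ[X]) =
        X ^ 4 + C (-(t + 3)) * X ^ 3 + C 0 * X ^ 2 + C t * X + C 1 := by
      simp only [map_neg, map_zero, map_one]
      ring
    obtain ⟨h3, -, h1, h0⟩ := coeffs_eq_of_quartic_eq (hprod.symm.trans (hfg.trans hquartic))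
    rcases Int.mul_eq_one_iff_eq_one_or_neg_one.mp h0 with ⟨hf0, hg0⟩ | ⟨hf0, hg0⟩ <;>
      rw [hf0, hg0] at h1 <;> omega

theorem irreducible_resolventCubic_int {t : ℤ} (ht : 4 ≤ t) :
    Irreducible (resolventCubic (-(t + 3)) 0 t 1).toPoly := by
  have hdeg := Cubic.natDegree_of_a_ne_zero (P := resolventCubic (-(t + 3)) 0 t 1) one_ne_zero
  rw [(Cubic.monic_of_a_eq_one rfl).irreducible_iff_roots_eq_zero_of_degree_le_three
    (by omega) (by omega)]
  refine Multiset.eq_zero_of_forall_notMem fun y hy ↦ ?_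
  have hroot := isRoot_of_mem_roots hy
  simp only [resolventCubic, Cubic.toPoly, IsRoot.def, eval_add, eval_mul, eval_pow, eval_X,
    eval_C] at hroot
  have hfac : 9 = (y + 2) * (y * (y - 2) - t * (t + 3)) := by linarith
  have hle := Int.le_of_dvd (by norm_num) (Dvd.intro _ hfac.symm)
  have hge := Int.le_of_dvd (by norm_num) (neg_dvd.mpr (Dvd.intro _ hfac.symm))
  have hy1 : -11 ≤ y := by omega
  have hy2 : y ≤ 7 := by omega
  have ht11 : t < 12 := by
    by_contra! h
    interval_cases y <;> nlinarith
  interval_cases t <;> interval_cases y <;> omega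

theorem not_isSquare_discr_resolventCubic_int (t : ℤ) :
    ¬ IsSquare (resolventCubic (-(t + 3)) 0 t 1).discr := by
  rintro ⟨n, hn⟩
  have hmod := congrArg (Int.cast : ℤ → ZMod 8) hn
  simp only [resolventCubic, Cubic.discr] at hmod
  push_cast at hmod
  generalize (t : ZMod 8) = u at hmod
  generalize (n : ZMod 8) = v at hmod
  revert u v
  decide

/-- For every integer `t ≥ 4`, the Galois group of the splitting field of
`g₄(x;t) = x⁴ − (t+3)·x³ + t·x + 1` over `ℚ` is isomorphic to the symmetric
group `S₄`. -/
theorem stmt_17 (t : ℤ) (ht : 4 ≤ t) :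
    Nonempty
      ((X ^ 4 - C ((t : ℚ) + 3) * X ^ 3 + C (t : ℚ) * X + 1 : Polynomial ℚ).Gal ≃*
        Equiv.Perm (Fin 4)) := by
  refine Gal.nonempty_mulEquiv_perm_fin_four (a := -((t : ℚ) + 3)) (b := 0) (c := t) (d := 1)
    ?_ ?_ ?_ ?_
  · simp only [map_neg, map_zero, map_one]
    ring
  · have h := (monic_quartic_int t).irreducible_iff_irreducible_map_fraction_map (K := ℚ) |>.mp
      (irreducible_quartic_int t)
    simpa [C_ofNat] using h
  · have h := (Cubic.monic_of_a_eq_one rfl).irreducible_iff_irreducible_map_fraction_map (K := ℚ)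
      |>.mp (irreducible_resolventCubic_int ht)
    simpa [resolventCubic, Cubic.toPoly, C_ofNat] using h
  · have h := Rat.isSquare_intCast_iff.not.mpr (not_isSquare_discr_resolventCubic_int t)
    simpa [resolventCubic, Cubic.discr] using h
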